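/- arXiv:0811.2735 — 2 statements merged into one kernel-verified Lean document; each statement's English description precedes it below -/
import Mathlib

section
/- Let β, h ≥ 0 and let x be a global minimizer of f_{β,h} on Ω. Then min_{1≤i≤q}(x_i) > 0, i.e. every coordinate of x is strictly positive. -/
open Real Filter Finset

/-- The simplex `Ω = {x ∈ ℝ^q : x_1 + ⋯ + x_q = 1, x_i ≥ 0}`. -/
def simplex (q : ℕ) : Set (Fin q → ℝ) := {x | (∀ i, 0 ≤ x i) ∧ ∑ i, x i = 1}

/-- The Curie–Weiss Potts free energy
`f_{β,h}(x) = ∑ x_i log x_i − (β/2) ∑ x_i² − h x_1` (with `0 log 0 = 0`). -/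
noncomputable def freeEnergy (q : ℕ) [NeZero q] (β h : ℝ) (x : Fin q → ℝ) : ℝ :=
  ∑ i, x i * Real.log (x i) - β / 2 * ∑ i, x i ^ 2 - h * x 0

/-- Changing a vector in two coordinates changes a separable sum only through these coordinates. -/
theorem sum_comp_update_update {ι : Type*} [Fintype ι] [DecidableEq ι] (g : ℝ → ℝ) (x : ι → ℝ)
    {i j : ι} (hij : i ≠ j) (a b : ℝ) :
    ∑ k, g (Function.update (Function.update x j b) i a k) =
      ∑ k, g (x k) + (g a - g (x i)) + (g b - g (x j)) := by
  have key := Fintype.sum_eq_add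
    (f := fun k => g (Function.update (Function.update x j b) i a k) - g (x k)) i j hij
    (fun k hk => by simp [Function.update_of_ne hk.1, Function.update_of_ne hk.2])
  simp only [Finset.sum_sub_distrib, Function.update_self, Function.update_of_ne hij.symm] at key
  linarith

/-- any global minimizer of the free energy has all coordinates
strictly positive. -/
theorem stmt_3 (q : ℕ) [NeZero q] (hq : 2 ≤ q) (β h : ℝ) (hβ : 0 ≤ β) (hh : 0 ≤ h)
    (x : Fin q → ℝ) (hx : x ∈ simplex q)
    (hmin : ∀ y ∈ simplex q, freeEnergy q β h x ≤ freeEnergy q β h y) :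
    ∀ i, 0 < x i := by
  intro i
  obtain ⟨hx0, hx1⟩ := hx
  refine (hx0 i).lt_of_ne' fun hi => ?_
  obtain ⟨j, hj⟩ : ∃ j, 0 < x j := by
    by_contra! hneg
    have := Finset.sum_nonpos fun k (_ : k ∈ Finset.univ) => hneg k
    linarith
  have hij : i ≠ j := by
    rintro rfl
    exact hj.ne' hi
  obtain ⟨ε, hε, hεj, hlog⟩ :
      ∃ ε, 0 < ε ∧ ε < x j ∧ Real.log ε = Real.log (x j) - (β * x j + h + 1) := by
    refine ⟨x j * Real.exp (-(β * x j + h + 1)), by positivity, ?_, ?_⟩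
    · refine mul_lt_of_lt_one_right hj (Real.exp_lt_one_iff.2 ?_)
      have : 0 ≤ β * x j := by positivity
      linarith
    · rw [Real.log_mul hj.ne' (Real.exp_pos _).ne', Real.log_exp]
      ring
  set y := Function.update (Function.update x j (x j - ε)) i ε with hy
  have hyk : ∀ k, x k - ε ≤ y k ∧ 0 ≤ y k := by
    intro k
    rcases eq_or_ne k i with rfl | hki
    · simp only [hy, Function.update_self, hi]
      constructor <;> linarith
    · rcases eq_or_ne k j with rfl | hkj
      · simp only [hy, Function.update_of_ne hki, Function.update_self]
        constructor <;> linarith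
      · simp only [hy, Function.update_of_ne hki, Function.update_of_ne hkj]
        exact ⟨by linarith, hx0 k⟩
  have hsum := sum_comp_update_update (fun t => t) x hij ε (x j - ε)
  have hent := sum_comp_update_update (fun t => t * Real.log t) x hij ε (x j - ε)
  have hsq := sum_comp_update_update (fun t => t ^ 2) x hij ε (x j - ε)
  simp only [← hy, hi] at hsum hent hsq
  have hle := hmin y ⟨fun k => (hyk k).2, by linarith⟩
  rw [freeEnergy, freeEnergy, hent, hsq, hlog] at hle
  have hlog' : (x j - ε) * Real.log (x j - ε) ≤ (x j - ε) * Real.log (x j) :=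
    mul_le_mul_of_nonneg_left (Real.log_le_log (by linarith) (by linarith)) (by linarith)
  have hfield : h * (x 0 - ε) ≤ h * y 0 := mul_le_mul_of_nonneg_left (hyk 0).1 hh
  have hquad : 0 ≤ β * ε ^ 2 := by positivity
  linarith
end

section
/- Fix an integer q ≥ 3 and z ∈ (0, (q−2)/q). Set β_z = 2((q−1)/q)(1/z) log((1+z)/(1−z)) and h_z = log(q−1) − (q−2)/(2(q−1)) · β_z, so that (β_z,h_z) ∈ h_T. Then the set of global minimizers of f_{β_z,h_z} on Ω is exactly {x_z, x_{−z}}. Moreover, x_z (respectively x_{−z}) is the limit of the unique global minimizer of f_{β,h} as (β,h) → (β_z,h_z) with (β,h) above (respectively below) the line h_T. -/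
open Real Filter Finset Topology

/-- The vector `x_z = ((1+z)/2, (1−z)/(2(q−1)), …, (1−z)/(2(q−1)))`. -/
noncomputable def xvec (q : ℕ) [NeZero q] (z : ℝ) : Fin q → ℝ :=
  fun i => if i = 0 then (1 + z) / 2 else (1 - z) / (2 * ((q : ℝ) - 1))

/-- The one-coordinate contribution to the free energy without external field. -/
noncomputable def siteEnergy (β t : ℝ) : ℝ := t * Real.log t - β / 2 * t ^ 2

lemma continuous_siteEnergy (β : ℝ) : Continuous (siteEnergy β) := by
  unfold siteEnergy
  exact Real.continuous_mul_log.sub (by fun_prop)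

lemma deriv2_siteEnergy (β : ℝ) {t : ℝ} (ht : 0 < t) :
    deriv^[2] (siteEnergy β) t = t⁻¹ - β := by
  have hderiv : ∀ x : ℝ, 0 < x → HasDerivAt (siteEnergy β) (Real.log x + 1 - β * x) x := by
    intro x hx
    have := (Real.hasDerivAt_mul_log hx.ne').sub (((hasDerivAt_id x).pow 2).const_mul (β / 2))
    refine this.congr_deriv ?_
    simp only [id]
    push_cast
    ring
  have heq : deriv (siteEnergy β) =ᶠ[𝓝 t] fun x => Real.log x + 1 - β * x := by
    filter_upwards [lt_mem_nhds ht] with x hx using (hderiv x hx).deriv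
  rw [Function.iterate_succ, Function.iterate_one, Function.comp_apply, heq.deriv_eq]
  have := ((Real.hasDerivAt_log ht.ne').add_const 1).sub ((hasDerivAt_id t).const_mul β)
  exact this.deriv.trans (by simp)

lemma strictConvexOn_siteEnergy {β : ℝ} (hβ : 0 < β) :
    StrictConvexOn ℝ (Set.Icc 0 β⁻¹) (siteEnergy β) := by
  refine strictConvexOn_of_deriv2_pos (convex_Icc _ _) (continuous_siteEnergy β).continuousOn ?_
  intro t ht
  rw [interior_Icc] at ht
  rw [deriv2_siteEnergy β ht.1, sub_pos]
  exact (lt_inv_comm₀ ht.1 hβ).1 ht.2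

lemma strictConcaveOn_siteEnergy {β : ℝ} (hβ : 0 < β) :
    StrictConcaveOn ℝ (Set.Ici β⁻¹) (siteEnergy β) := by
  refine strictConcaveOn_of_deriv2_neg (convex_Ici _) (continuous_siteEnergy β).continuousOn ?_
  intro t ht
  rw [interior_Ici] at ht
  have ht0 : 0 < t := (inv_pos.2 hβ).trans ht
  rw [deriv2_siteEnergy β ht0, sub_neg]
  exact (inv_lt_comm₀ hβ ht0).1 ht

lemma freeEnergy_eq_sum_siteEnergy (q : ℕ) [NeZero q] (β h : ℝ) (x : Fin q → ℝ) :
    freeEnergy q β h x = ∑ i, siteEnergy β (x i) - h * x 0 := by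
  simp only [freeEnergy, siteEnergy, Finset.sum_sub_distrib, Finset.mul_sum]

lemma continuous_freeEnergy (q : ℕ) [NeZero q] (β h : ℝ) : Continuous (freeEnergy q β h) := by
  simp only [funext (freeEnergy_eq_sum_siteEnergy q β h)]
  refine Continuous.sub (continuous_finsetSum _ fun i _ => ?_) (by fun_prop)
  exact (continuous_siteEnergy β).comp (continuous_apply i)

lemma isCompact_simplex (q : ℕ) : IsCompact (simplex q) := by
  have : simplex q = stdSimplex ℝ (Fin q) := rfl
  rw [this]
  exact isCompact_stdSimplex ℝ (Fin q)

lemma sum_apply_update_update {ι : Type*} [Fintype ι] [DecidableEq ι] (F : ℝ → ℝ) (y : ι → ℝ)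
    {i j : ι} (hij : i ≠ j) (a b : ℝ) :
    ∑ k, F (Function.update (Function.update y i a) j b k)
      = ∑ k, F (y k) - F (y i) - F (y j) + F a + F b := by
  have key : ∀ w : ι → ℝ, ∑ k, F (w k) = F (w i) + F (w j) + ∑ k ∈ {i, j}ᶜ, F (w k) := by
    intro w
    rw [← Finset.sum_add_sum_compl {i, j}, Finset.sum_pair hij]
  rw [key, key y]
  have hrest : ∑ k ∈ ({i, j} : Finset ι)ᶜ, F (Function.update (Function.update y i a) j b k)
      = ∑ k ∈ ({i, j} : Finset ι)ᶜ, F (y k) := by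
    refine Finset.sum_congr rfl fun k hk => ?_
    simp only [Finset.mem_compl, Finset.mem_insert, Finset.mem_singleton, not_or] at hk
    rw [Function.update_of_ne hk.2, Function.update_of_ne hk.1]
  rw [hrest, Function.update_of_ne hij, Function.update_self, Function.update_self]
  ring

lemma update_update_mem_simplex {q : ℕ} {y : Fin q → ℝ} (hy : y ∈ simplex q) {i j : Fin q}
    (hij : i ≠ j) {a b : ℝ} (ha : 0 ≤ a) (hb : 0 ≤ b) (hab : a + b = y i + y j) :
    Function.update (Function.update y i a) j b ∈ simplex q := by
  refine ⟨fun k => ?_, ?_⟩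
  · rcases eq_or_ne k j with rfl | hkj
    · simpa using hb
    rw [Function.update_of_ne hkj]
    rcases eq_or_ne k i with rfl | hki
    · simpa using ha
    rw [Function.update_of_ne hki]
    exact hy.1 k
  · have := sum_apply_update_update id y hij a b
    simp only [id] at this
    rw [this, hy.2]
    linarith

section Minimizer

variable {q : ℕ} [NeZero q] {β h : ℝ} {y : Fin q → ℝ}

lemma siteEnergy_le_of_minimizer (hy : y ∈ simplex q)
    (hmin : ∀ w ∈ simplex q, freeEnergy q β h y ≤ freeEnergy q β h w) {i j : Fin q}
    (hij : i ≠ j) {a b : ℝ} (ha : 0 ≤ a) (hb : 0 ≤ b) (hab : a + b = y i + y j) :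
    siteEnergy β (y i) + siteEnergy β (y j) - h * y 0
      ≤ siteEnergy β a + siteEnergy β b
        - h * Function.update (Function.update y i a) j b 0 := by
  have := hmin _ (update_update_mem_simplex hy hij ha hb hab)
  rw [freeEnergy_eq_sum_siteEnergy, freeEnergy_eq_sum_siteEnergy,
    sum_apply_update_update _ _ hij] at this
  linarith

lemma le_apply_zero_of_minimizer (hh : 0 < h) (hy : y ∈ simplex q)
    (hmin : ∀ w ∈ simplex q, freeEnergy q β h y ≤ freeEnergy q β h w) (j : Fin q) :
    y j ≤ y 0 := by
  rcases eq_or_ne j 0 with rfl | hj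
  · exact le_rfl
  have := siteEnergy_le_of_minimizer hy hmin hj.symm (hy.1 j) (hy.1 0) (add_comm _ _)
  rw [Function.update_of_ne hj.symm, Function.update_self] at this
  nlinarith

lemma apply_le_inv_of_minimizer (hβ : 0 < β) (hh : 0 < h) (hy : y ∈ simplex q)
    (hmin : ∀ w ∈ simplex q, freeEnergy q β h y ≤ freeEnergy q β h w) {j : Fin q}
    (hj : j ≠ 0) : y j ≤ β⁻¹ := by
  by_contra! hlt
  have h0 := le_apply_zero_of_minimizer hh hy hmin j
  have hβ' : 0 < β⁻¹ := inv_pos.2 hβ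
  obtain ⟨t, ht⟩ : ∃ t, t = y j - β⁻¹ := ⟨_, rfl⟩
  have hplus := siteEnergy_le_of_minimizer hy hmin hj.symm (a := y 0 + t) (b := y j - t)
    (by linarith) (by linarith) (by ring)
  have hminus := siteEnergy_le_of_minimizer hy hmin hj.symm (a := y 0 - t) (b := y j + t)
    (by linarith) (by linarith) (by ring)
  rw [Function.update_of_ne hj.symm, Function.update_self] at hplus hminus
  have hmid : ∀ x, β⁻¹ ≤ x - t →
      siteEnergy β (x - t) + siteEnergy β (x + t) < 2 * siteEnergy β x := by
    intro x hx
    have := (strictConcaveOn_siteEnergy hβ).2 (Set.mem_Ici.2 hx)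
      (Set.mem_Ici.2 (by linarith : β⁻¹ ≤ x + t)) (by linarith) (by norm_num : (0 : ℝ) < 1 / 2)
      (by norm_num : (0 : ℝ) < 1 / 2) (by norm_num)
    simp only [smul_eq_mul] at this
    rw [show (1 / 2 : ℝ) * (x - t) + 1 / 2 * (x + t) = x by ring] at this
    linarith
  have := hmid (y 0) (by linarith)
  have := hmid (y j) (by linarith)
  linarith

lemma apply_eq_apply_of_minimizer (hβ : 0 < β) (hh : 0 < h) (hy : y ∈ simplex q)
    (hmin : ∀ w ∈ simplex q, freeEnergy q β h y ≤ freeEnergy q β h w) {i j : Fin q}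
    (hi : i ≠ 0) (hj : j ≠ 0) : y i = y j := by
  by_contra hne
  have hij : i ≠ j := fun e => hne (congrArg y e)
  have hyi := hy.1 i
  have hyj := hy.1 j
  have hconv := (strictConvexOn_siteEnergy hβ).2
    ⟨hyi, apply_le_inv_of_minimizer hβ hh hy hmin hi⟩
    ⟨hyj, apply_le_inv_of_minimizer hβ hh hy hmin hj⟩ hne (by norm_num : (0 : ℝ) < 1 / 2)
    (by norm_num : (0 : ℝ) < 1 / 2) (by norm_num)
  simp only [smul_eq_mul] at hconv
  have := siteEnergy_le_of_minimizer hy hmin hij (a := 1 / 2 * y i + 1 / 2 * y j)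
    (b := 1 / 2 * y i + 1 / 2 * y j) (by linarith) (by linarith) (by ring)
  rw [Function.update_of_ne hj.symm, Function.update_of_ne hi.symm] at this
  linarith

end Minimizer

lemma sum_ite_eq_zero (q : ℕ) [NeZero q] (a b : ℝ) :
    ∑ i : Fin q, (if i = 0 then a else b) = a + ((q : ℝ) - 1) * b := by
  have hq : 1 ≤ q := NeZero.one_le
  rw [← Finset.add_sum_erase _ _ (Finset.mem_univ 0), if_pos rfl]
  rw [Finset.sum_congr rfl fun i hi => if_neg (Finset.ne_of_mem_erase hi), Finset.sum_const,
    Finset.card_erase_of_mem (Finset.mem_univ _), Finset.card_univ, Fintype.card_fin, nsmul_eq_mul,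
    Nat.cast_sub hq, Nat.cast_one]

lemma exists_eq_xvec_of_minimizer {q : ℕ} [NeZero q] (hq : 1 < q) {β h : ℝ} (hβ : 0 < β)
    (hh : 0 < h) {y : Fin q → ℝ} (hy : y ∈ simplex q)
    (hmin : ∀ w ∈ simplex q, freeEnergy q β h y ≤ freeEnergy q β h w) :
    ∃ s ∈ Set.Icc (-1 : ℝ) 1, y = xvec q s := by
  have hq' : (1 : ℝ) < q := by exact_mod_cast hq
  let j : Fin q := ⟨1, hq⟩
  have hj : j ≠ 0 := fun e => by simpa [j] using congrArg Fin.val e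
  have hyite : ∀ i, y i = if i = 0 then y 0 else y j := by
    intro i
    split_ifs with hi
    · rw [hi]
    · exact apply_eq_apply_of_minimizer hβ hh hy hmin hi hj
  have hsum := hy.2
  rw [Finset.sum_congr rfl fun i _ => hyite i, sum_ite_eq_zero] at hsum
  have h0 := hy.1 0
  have hj0 := mul_nonneg (sub_nonneg.2 hq'.le) (hy.1 j)
  refine ⟨2 * y 0 - 1, ⟨by linarith, by linarith⟩, funext fun i => ?_⟩
  rw [hyite i, xvec]
  split_ifs
  · ring
  · rw [eq_div_iff (by linarith)]
    linarith

lemma xvec_mem_simplex {q : ℕ} [NeZero q] (hq : 1 < q) {s : ℝ} (hs : s ∈ Set.Icc (-1 : ℝ) 1) :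
    xvec q s ∈ simplex q := by
  have hq' : (0 : ℝ) < q - 1 := sub_pos.2 (by exact_mod_cast hq)
  refine ⟨fun i => ?_, ?_⟩
  · unfold xvec
    split_ifs
    · linarith [hs.1]
    · exact div_nonneg (by linarith [hs.2]) (by linarith)
  · unfold xvec
    rw [sum_ite_eq_zero]
    field_simp
    ring

lemma abs_xvec_sub_xvec_le {q : ℕ} [NeZero q] (hq : 2 ≤ q) (s z : ℝ) (i : Fin q) :
    |xvec q s i - xvec q z i| ≤ |s - z| := by
  have hq' : (2 : ℝ) ≤ q := by exact_mod_cast hq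
  unfold xvec
  split_ifs
  · rw [show (1 + s) / 2 - (1 + z) / 2 = (s - z) / 2 by ring, abs_div, abs_two]
    linarith [abs_nonneg (s - z)]
  · rw [show (1 - s) / (2 * ((q : ℝ) - 1)) - (1 - z) / (2 * (q - 1))
      = -(s - z) / (2 * (q - 1)) by ring, abs_div, abs_neg]
    refine div_le_self (abs_nonneg _) ?_
    rw [abs_of_pos (by linarith)]
    linarith

/-- The Curie–Weiss free energy with zero field at magnetization `s`. -/
noncomputable def isingEnergy (c s : ℝ) : ℝ :=
  (1 + s) / 2 * Real.log ((1 + s) / 2) + (1 - s) / 2 * Real.log ((1 - s) / 2) - c / 2 * s ^ 2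

lemma isingEnergy_neg (c s : ℝ) : isingEnergy c (-s) = isingEnergy c s := by
  unfold isingEnergy
  rw [sub_neg_eq_add, ← sub_eq_add_neg]
  ring

lemma isingEnergy_abs (c s : ℝ) : isingEnergy c |s| = isingEnergy c s := by
  rcases abs_choice s with h | h <;> simp only [h, isingEnergy_neg]

lemma continuous_isingEnergy (c : ℝ) : Continuous (isingEnergy c) := by
  unfold isingEnergy
  refine Continuous.sub (Continuous.add ?_ ?_) (by fun_prop)
  · exact Real.continuous_mul_log.comp (by fun_prop : Continuous fun s : ℝ => (1 + s) / 2)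
  · exact Real.continuous_mul_log.comp (by fun_prop : Continuous fun s : ℝ => (1 - s) / 2)

lemma hasDerivAt_isingEnergy (c : ℝ) {s : ℝ} (hs : s ∈ Set.Ioo (-1 : ℝ) 1) :
    HasDerivAt (isingEnergy c) (1 / 2 * (Real.log (1 + s) - Real.log (1 - s)) - c * s) s := by
  have hp : (1 + s) / 2 ≠ 0 := by linarith [hs.1]
  have hm : (1 - s) / 2 ≠ 0 := by linarith [hs.2]
  have h1 := (Real.hasDerivAt_mul_log hp).comp s (((hasDerivAt_id s).const_add 1).div_const 2)
  have h2 := (Real.hasDerivAt_mul_log hm).comp s (((hasDerivAt_id s).const_sub 1).div_const 2)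
  refine ((h1.add h2).sub (((hasDerivAt_id s).pow 2).const_mul (c / 2))).congr_deriv ?_
  rw [Real.log_div (by linarith [hs.1]) two_ne_zero, Real.log_div (by linarith [hs.2]) two_ne_zero]
  simp only [id]
  push_cast
  ring

lemma strictConvexOn_log_one_add_sub_log_one_sub :
    StrictConvexOn ℝ (Set.Ico (0 : ℝ) 1) fun s => Real.log (1 + s) - Real.log (1 - s) := by
  have hd : ∀ s ∈ Set.Ico (0 : ℝ) 1,
      HasDerivAt (fun s => Real.log (1 + s) - Real.log (1 - s)) (2 / (1 - s ^ 2)) s := by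
    intro s hs
    have hp : 1 + s ≠ 0 := by linarith [hs.1]
    have hm : 1 - s ≠ 0 := by linarith [hs.2]
    refine ((((hasDerivAt_id s).const_add 1).log hp).sub
      (((hasDerivAt_id s).const_sub 1).log hm)).congr_deriv ?_
    simp only [id]
    rw [show 1 - s ^ 2 = (1 + s) * (1 - s) by ring]
    field_simp
    ring
  refine StrictMonoOn.strictConvexOn_of_deriv (convex_Ico _ _)
    (fun s hs => (hd s hs).continuousAt.continuousWithinAt) ?_
  rw [interior_Ico]
  intro a ha b hb hab
  rw [(hd a ⟨ha.1.le, ha.2⟩).deriv, (hd b ⟨hb.1.le, hb.2⟩).deriv]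
  refine div_lt_div_of_pos_left two_pos ?_ ?_
  · nlinarith [hb.1, hb.2]
  · nlinarith [ha.1]

section Ising

variable {c z : ℝ}

lemma log_one_add_sub_log_one_sub_div_lt {a b : ℝ} (ha : 0 < a) (hab : a < b) (hb : b < 1) :
    (Real.log (1 + a) - Real.log (1 - a)) / a < (Real.log (1 + b) - Real.log (1 - b)) / b := by
  have := strictConvexOn_log_one_add_sub_log_one_sub.secant_strict_mono (a := 0) (x := a) (y := b)
    ⟨le_rfl, one_pos⟩ ⟨ha.le, hab.trans hb⟩ ⟨(ha.trans hab).le, hb⟩ ha.ne' (ha.trans hab).ne' hab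
  simpa using this

lemma isingEnergy_lt_of_ne (hz0 : 0 < z) (hz1 : z < 1)
    (hc : c = (Real.log (1 + z) - Real.log (1 - z)) / (2 * z)) {s : ℝ} (hs : s ∈ Set.Icc (0 : ℝ) 1)
    (hsz : s ≠ z) : isingEnergy c z < isingEnergy c s := by
  have hc' : c = (Real.log (1 + z) - Real.log (1 - z)) / z / 2 := by
    rw [hc, div_div, mul_comm]
  rcases lt_or_gt_of_ne hsz with hlt | hgt
  · have : StrictAntiOn (isingEnergy c) (Set.Icc 0 z) := by
      refine strictAntiOn_of_deriv_neg (convex_Icc _ _) (continuous_isingEnergy c).continuousOn ?_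
      rw [interior_Icc]
      intro x hx
      rw [(hasDerivAt_isingEnergy c ⟨by linarith [hx.1], by linarith [hx.2]⟩).deriv]
      have := log_one_add_sub_log_one_sub_div_lt hx.1 hx.2 hz1
      rw [div_lt_iff₀ hx.1] at this
      rw [hc']
      linarith
    exact this ⟨hs.1, hlt.le⟩ ⟨hz0.le, le_rfl⟩ hlt
  · have : StrictMonoOn (isingEnergy c) (Set.Icc z 1) := by
      refine strictMonoOn_of_deriv_pos (convex_Icc _ _) (continuous_isingEnergy c).continuousOn ?_
      rw [interior_Icc]
      intro x hx
      have hx0 : 0 < x := hz0.trans hx.1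
      rw [(hasDerivAt_isingEnergy c ⟨by linarith [hx.1], by linarith [hx.2]⟩).deriv]
      have := log_one_add_sub_log_one_sub_div_lt hz0 hx.1 hx.2
      rw [lt_div_iff₀ hx0] at this
      rw [hc']
      linarith
    exact this ⟨le_rfl, hz1.le⟩ ⟨hgt.le, hs.2⟩ hgt

lemma isingEnergy_lt_of_abs_ne (hz0 : 0 < z) (hz1 : z < 1)
    (hc : c = (Real.log (1 + z) - Real.log (1 - z)) / (2 * z)) {s : ℝ}
    (hs : s ∈ Set.Icc (-1 : ℝ) 1) (hsz : |s| ≠ z) : isingEnergy c z < isingEnergy c s := by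
  rw [← isingEnergy_abs c s]
  exact isingEnergy_lt_of_ne hz0 hz1 hc ⟨abs_nonneg s, abs_le.2 hs⟩ hsz

lemma exists_isingEnergy_gap (hz0 : 0 < z) (hz1 : z < 1)
    (hc : c = (Real.log (1 + z) - Real.log (1 - z)) / (2 * z)) {η : ℝ} (hη : 0 < η) :
    ∃ m > 0, ∀ s ∈ Set.Icc (-1 : ℝ) 1, η ≤ |(|s| - z)| →
      isingEnergy c z + m ≤ isingEnergy c s := by
  let K : Set ℝ := Set.Icc (-1 : ℝ) 1 ∩ {s | η ≤ |(|s| - z)|}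
  have hK : IsCompact K :=
    isCompact_Icc.inter_right (isClosed_le continuous_const (by fun_prop))
  rcases K.eq_empty_or_nonempty with hempty | hne
  · exact ⟨1, one_pos, fun s hs hsη =>
      absurd ⟨hs, hsη⟩ (Set.eq_empty_iff_forall_notMem.1 hempty s)⟩
  · obtain ⟨s₀, hs₀, hmin⟩ := hK.exists_isMinOn hne (continuous_isingEnergy c).continuousOn
    refine ⟨isingEnergy c s₀ - isingEnergy c z, sub_pos.2 ?_, fun s hs hsη => ?_⟩
    · refine isingEnergy_lt_of_abs_ne hz0 hz1 hc hs₀.1 fun e => ?_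
      have := hs₀.2
      rw [Set.mem_ofPred_eq, e, sub_self, abs_zero] at this
      linarith
    · have : isingEnergy c s₀ ≤ isingEnergy c s := hmin ⟨hs, hsη⟩
      linarith

end Ising

/-- The field on the (extended) critical line at inverse temperature `β`. -/
noncomputable def criticalField (q : ℕ) (β : ℝ) : ℝ :=
  Real.log ((q : ℝ) - 1) - β * ((q : ℝ) - 2) / (2 * ((q : ℝ) - 1))

lemma freeEnergy_xvec {q : ℕ} [NeZero q] (hq : 1 < q) (β h s : ℝ) :
    freeEnergy q β h (xvec q s) = isingEnergy (β * q / (4 * (q - 1))) s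
      - s / 2 * (h - criticalField q β)
      - (Real.log ((q : ℝ) - 1) / 2 + β * q / (8 * (q - 1)) + h / 2) := by
  have hq' : (0 : ℝ) < q - 1 := sub_pos.2 (by exact_mod_cast hq)
  have hlog : ((q : ℝ) - 1) * ((1 - s) / (2 * (q - 1)) * Real.log ((1 - s) / (2 * (q - 1))))
      = (1 - s) / 2 * (Real.log ((1 - s) / 2) - Real.log (q - 1)) := by
    rcases eq_or_ne ((1 - s) / 2) 0 with h0 | h0
    · rw [← div_div, h0]
      simp
    · rw [← div_div, Real.log_div h0 hq'.ne']
      field_simp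
  have hsum : ∑ i, siteEnergy β (xvec q s i)
      = siteEnergy β ((1 + s) / 2) + (q - 1) * siteEnergy β ((1 - s) / (2 * (q - 1))) := by
    simp only [xvec, apply_ite (siteEnergy β), sum_ite_eq_zero]
  rw [freeEnergy_eq_sum_siteEnergy, hsum]
  simp only [siteEnergy, mul_sub ((q : ℝ) - 1), hlog, xvec, if_true, isingEnergy, criticalField]
  field_simp
  ring

lemma isingEnergy_eq_add (c c' s : ℝ) :
    isingEnergy c s = isingEnergy c' s - (c - c') / 2 * s ^ 2 := by
  unfold isingEnergy
  ring

lemma criticalField_pos {q : ℕ} (hq : 3 ≤ q) {z β : ℝ} (hz0 : 0 < z)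
    (hz1 : z < ((q : ℝ) - 2) / q)
    (hβ : β = 2 * ((q : ℝ) - 1) / q * ((Real.log (1 + z) - Real.log (1 - z)) / z)) :
    0 < criticalField q β := by
  have hq' : (3 : ℝ) ≤ q := by exact_mod_cast hq
  have hq0 : (0 : ℝ) < q := by linarith
  have hq1 : (0 : ℝ) < q - 1 := by linarith
  have hq2 : (0 : ℝ) < q - 2 := by linarith
  have hlt := log_one_add_sub_log_one_sub_div_lt hz0 hz1
    (by rw [div_lt_one hq0]; linarith)
  rw [show 1 + ((q : ℝ) - 2) / q = 2 * (q - 1) / q by field_simp; ring,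
    show 1 - ((q : ℝ) - 2) / q = 2 / q by field_simp; ring,
    ← Real.log_div (x := 2 * ((q : ℝ) - 1) / q) (y := 2 / q) (by positivity)
      (by positivity),
    show 2 * ((q : ℝ) - 1) / q / (2 / q) = q - 1 by field_simp, div_div_eq_mul_div,
    lt_div_iff₀ hq2] at hlt
  have heq : criticalField q β = (Real.log ((q : ℝ) - 1) * q
      - (Real.log (1 + z) - Real.log (1 - z)) / z * (q - 2)) / q := by
    rw [criticalField, hβ]
    field_simp
  rw [heq]
  exact div_pos (sub_pos.2 hlt) hq0

/-- Near a point of the critical line, every minimizer is some `xvec q s` with `|s|` close to `z`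
and `s` having the sign of the distance of the field to the critical line. -/
lemma exists_delta_minimizer_eq_xvec {q : ℕ} [NeZero q] (hq : 2 ≤ q) {z β₀ : ℝ} (hz0 : 0 < z)
    (hz1 : z < 1) (hβ₀ : 0 < β₀) (hh₀ : 0 < criticalField q β₀)
    (hc : β₀ * q / (4 * (q - 1)) = (Real.log (1 + z) - Real.log (1 - z)) / (2 * z))
    {ε : ℝ} (hε : 0 < ε) :
    ∃ δ > 0, ∀ β h : ℝ, |β - β₀| < δ → |h - criticalField q β₀| < δ → ∀ y ∈ simplex q,
      (∀ w ∈ simplex q, freeEnergy q β h y ≤ freeEnergy q β h w) →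
        ∃ s, y = xvec q s ∧ |(|s| - z)| < ε ∧ 0 ≤ s * (h - criticalField q β) := by
  have hq' : (2 : ℝ) ≤ q := by exact_mod_cast hq
  have hq1 : (0 : ℝ) < q - 1 := by linarith
  obtain ⟨m, hm, hgap⟩ := exists_isingEnergy_gap hz0 hz1 hc hε
  refine ⟨min β₀ (min (criticalField q β₀) (m / 4)), by positivity, ?_⟩
  intro β h hβ hh y hy hmin
  simp only [lt_min_iff] at hβ hh
  have hβ0 : 0 < β := by linarith [(abs_lt.1 hβ.1).1]
  have hh0 : 0 < h := by linarith [(abs_lt.1 hh.2.1).1]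
  obtain ⟨s, hs, rfl⟩ := exists_eq_xvec_of_minimizer hq hβ0 hh0 hy hmin
  refine ⟨s, rfl, ?_, ?_⟩
  · by_contra! hfar
    have hle := hmin _ (xvec_mem_simplex hq ⟨by linarith, hz1.le⟩ : xvec q z ∈ simplex q)
    rw [freeEnergy_xvec hq, freeEnergy_xvec hq, isingEnergy_eq_add _ (β₀ * q / (4 * (q - 1))) s,
      isingEnergy_eq_add _ (β₀ * q / (4 * (q - 1))) z] at hle
    have hcoupling : |β * q / (4 * (q - 1)) - β₀ * q / (4 * (q - 1))| ≤ m / 4 := by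
      rw [show β * q / (4 * (q - 1)) - β₀ * q / (4 * ((q : ℝ) - 1))
        = (β - β₀) * (q / (4 * (q - 1))) by ring, abs_mul]
      have : |(q : ℝ) / (4 * (q - 1))| ≤ 1 := by
        rw [abs_of_nonneg (by positivity), div_le_one (by positivity)]
        linarith
      exact (mul_le_of_le_one_right (abs_nonneg _) this).trans hβ.2.2.le
    have hfield : |h - criticalField q β| ≤ m / 2 := by
      rw [show h - criticalField q β = (h - criticalField q β₀)
        + (β - β₀) * ((q - 2) / (2 * (q - 1))) by unfold criticalField; ring]
      refine (abs_add_le _ _).trans ?_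
      rw [abs_mul]
      have : |((q : ℝ) - 2) / (2 * (q - 1))| ≤ 1 := by
        rw [abs_of_nonneg (div_nonneg (by linarith) (by positivity)), div_le_one (by positivity)]
        linarith
      linarith [mul_le_of_le_one_right (abs_nonneg (β - β₀)) this, hh.2.2, hβ.2.2]
    have hsz : |s ^ 2 - z ^ 2| ≤ 1 := by
      rw [abs_le]
      constructor <;> nlinarith [hs.1, hs.2]
    have hsz' : |s - z| ≤ 2 := by
      rw [abs_le]
      constructor <;> linarith [hs.1, hs.2]
    have h1 := (le_abs_self _).trans_eq (abs_mul (β * q / (4 * (q - 1)) - β₀ * q / (4 * (q - 1)))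
      (s ^ 2 - z ^ 2))
    have h2 := (le_abs_self _).trans_eq (abs_mul (h - criticalField q β) (s - z))
    have h3 := mul_le_mul hcoupling hsz (abs_nonneg _) (by positivity)
    have h4 := mul_le_mul hfield hsz' (abs_nonneg _) (by positivity)
    linarith [hgap s hs hfar]
  · have hle := hmin _ (xvec_mem_simplex hq ⟨by linarith [hs.2], by linarith [hs.1]⟩ :
      xvec q (-s) ∈ simplex q)
    rw [freeEnergy_xvec hq, freeEnergy_xvec hq, isingEnergy_neg] at hle
    linarith

lemma minimizers_on_criticalField {q : ℕ} [NeZero q] (hq : 2 ≤ q) {z β₀ : ℝ} (hz0 : 0 < z)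
    (hz1 : z < 1) (hβ₀ : 0 < β₀) (hh₀ : 0 < criticalField q β₀)
    (hc : β₀ * q / (4 * (q - 1)) = (Real.log (1 + z) - Real.log (1 - z)) / (2 * z)) :
    {y | y ∈ simplex q ∧ ∀ w ∈ simplex q,
        freeEnergy q β₀ (criticalField q β₀) y ≤ freeEnergy q β₀ (criticalField q β₀) w}
      = {xvec q z, xvec q (-z)} := by
  have hzmem : xvec q z ∈ simplex q := xvec_mem_simplex hq ⟨by linarith, hz1.le⟩
  have hnegmem : xvec q (-z) ∈ simplex q := xvec_mem_simplex hq ⟨by linarith, by linarith⟩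
  have hneg : freeEnergy q β₀ (criticalField q β₀) (xvec q (-z))
      = freeEnergy q β₀ (criticalField q β₀) (xvec q z) := by
    rw [freeEnergy_xvec hq, freeEnergy_xvec hq, isingEnergy_neg]
    ring
  have hsub : ∀ y ∈ simplex q, (∀ w ∈ simplex q,
      freeEnergy q β₀ (criticalField q β₀) y ≤ freeEnergy q β₀ (criticalField q β₀) w) →
      y = xvec q z ∨ y = xvec q (-z) := by
    intro y hy hmin
    obtain ⟨s, hs, rfl⟩ := exists_eq_xvec_of_minimizer hq hβ₀ hh₀ hy hmin
    have hle := hmin _ hzmem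
    rw [freeEnergy_xvec hq, freeEnergy_xvec hq] at hle
    have habs : |s| = z := by
      by_contra hne
      linarith [isingEnergy_lt_of_abs_ne hz0 hz1 hc hs hne]
    rcases (abs_eq hz0.le).1 habs with rfl | rfl
    · exact Or.inl rfl
    · exact Or.inr rfl
  obtain ⟨y, hy, hymin⟩ := (isCompact_simplex q).exists_isMinOn ⟨_, hzmem⟩
    (continuous_freeEnergy q β₀ (criticalField q β₀)).continuousOn
  have hyz : freeEnergy q β₀ (criticalField q β₀) y
      = freeEnergy q β₀ (criticalField q β₀) (xvec q z) := by
    rcases hsub y hy fun w hw => hymin hw with rfl | rfl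
    · rfl
    · exact hneg
  ext x
  constructor
  · exact fun hx => hsub x hx.1 hx.2
  · rintro (rfl | rfl)
    · exact ⟨hzmem, fun w hw => hyz ▸ hymin hw⟩
    · exact ⟨hnegmem, fun w hw => hneg ▸ hyz ▸ hymin hw⟩

/-- on the critical line (parametrized by `z ∈ (0,(q−2)/q)`) the set of
global minimizers of `f_{β_z,h_z}` is exactly `{x_z, x_{−z}}`; moreover `x_z`
(resp. `x_{−z}`) is the limit of the unique global minimizer of `f_{β,h}` as
`(β,h) → (β_z,h_z)` from above (resp. below) the line `h_T`. -/
theorem stmt_6 (q : ℕ) [NeZero q] (hq : 3 ≤ q) (z : ℝ)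
    (hz0 : 0 < z) (hz1 : z < ((q : ℝ) - 2) / q)
    (βz hz : ℝ)
    (hβz : βz = 2 * ((q : ℝ) - 1) / q * (1 / z) * Real.log ((1 + z) / (1 - z)))
    (hhz : hz = Real.log ((q : ℝ) - 1) - ((q : ℝ) - 2) / (2 * ((q : ℝ) - 1)) * βz) :
    ({y | y ∈ simplex q ∧ ∀ w ∈ simplex q, freeEnergy q βz hz y ≤ freeEnergy q βz hz w}
        = {xvec q z, xvec q (-z)}) ∧
    (∀ ε > (0 : ℝ), ∃ δ > (0 : ℝ), ∀ β h : ℝ, |β - βz| < δ → |h - hz| < δ →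
      Real.log ((q : ℝ) - 1) - β * ((q : ℝ) - 2) / (2 * ((q : ℝ) - 1)) < h →
      ∀ y ∈ simplex q, (∀ w ∈ simplex q, freeEnergy q β h y ≤ freeEnergy q β h w) →
        ∀ i, |y i - xvec q z i| < ε) ∧
    (∀ ε > (0 : ℝ), ∃ δ > (0 : ℝ), ∀ β h : ℝ, |β - βz| < δ → |h - hz| < δ →
      h < Real.log ((q : ℝ) - 1) - β * ((q : ℝ) - 2) / (2 * ((q : ℝ) - 1)) →
      ∀ y ∈ simplex q, (∀ w ∈ simplex q, freeEnergy q β h y ≤ freeEnergy q β h w) →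
        ∀ i, |y i - xvec q (-z) i| < ε) := by
  have hq' : (3 : ℝ) ≤ q := by exact_mod_cast hq
  have hq1 : (0 : ℝ) < q - 1 := by linarith
  have hq2 : 2 ≤ q := by omega
  have hzlt : z < 1 := hz1.trans ((div_lt_one (by linarith)).2 (by linarith))
  have hpos : 0 < Real.log (1 + z) - Real.log (1 - z) :=
    sub_pos.2 (Real.log_lt_log (by linarith) (by linarith))
  have hβ : βz = 2 * ((q : ℝ) - 1) / q * ((Real.log (1 + z) - Real.log (1 - z)) / z) := by
    rw [hβz, Real.log_div (by linarith) (by linarith)]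
    ring
  have hβ0 : 0 < βz := by
    rw [hβ]
    positivity
  have hh0 : 0 < criticalField q βz := criticalField_pos hq hz0 hz1 hβ
  have hhz' : hz = criticalField q βz := by
    rw [hhz, criticalField]
    ring
  have hc : βz * q / (4 * (q - 1)) = (Real.log (1 + z) - Real.log (1 - z)) / (2 * z) := by
    rw [hβ]
    field_simp
    norm_num
  rw [hhz']
  refine ⟨minimizers_on_criticalField hq2 hz0 hzlt hβ0 hh0 hc, fun ε hε => ?_, fun ε hε => ?_⟩
  · obtain ⟨δ, hδ, H⟩ := exists_delta_minimizer_eq_xvec hq2 hz0 hzlt hβ0 hh0 hc hε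
    refine ⟨δ, hδ, fun β h hβδ hhδ habove y hy hmin i => ?_⟩
    obtain ⟨s, rfl, hsz, hsign⟩ := H β h hβδ hhδ y hy hmin
    have hs : 0 ≤ s := nonneg_of_mul_nonneg_left hsign (sub_pos.2 habove)
    rw [abs_of_nonneg hs] at hsz
    exact (abs_xvec_sub_xvec_le hq2 s z i).trans_lt hsz
  · obtain ⟨δ, hδ, H⟩ := exists_delta_minimizer_eq_xvec hq2 hz0 hzlt hβ0 hh0 hc hε
    refine ⟨δ, hδ, fun β h hβδ hhδ hbelow y hy hmin i => ?_⟩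
    obtain ⟨s, rfl, hsz, hsign⟩ := H β h hβδ hhδ y hy hmin
    have hs : s ≤ 0 := nonpos_of_mul_nonneg_left hsign (sub_neg.2 hbelow)
    rw [abs_of_nonpos hs, ← neg_add', abs_neg, ← sub_neg_eq_add] at hsz
    exact (abs_xvec_sub_xvec_le hq2 s (-z) i).trans_lt hsz
end
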